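/- A subset S of ℂ is disconnected if and only if there exists a closed connected set E ⊂ ℂ such that S ∩ E = ∅ and at least two different connected components of the complement ℂ \ E intersect S. -/

import Mathlib

open Set Topology in
/-- The plane is unicoherent. -/
theorem plane_unicoherent (A B : Set ℂ) (hA : IsClosed A) (hB : IsClosed B)
    (cA : IsPreconnected A) (cB : IsPreconnected B) (hAB : A ∪ B = univ) :
    IsPreconnected (A ∩ B) := by
  classical
  rw [isPreconnected_closed_iff]
  intro t t' ht ht' hcov ⟨p, hp, hpt⟩ ⟨q, hq, hqt⟩
  by_contra hne
  rw [not_nonempty_iff_eq_empty] at hne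
  have hdis : Disjoint (A ∩ B ∩ t) (A ∩ B ∩ t') := by
    rw [disjoint_left]
    rintro x ⟨hx, h1⟩ ⟨_, h2⟩
    exact (eq_empty_iff_forall_notMem.mp hne x) ⟨hx, h1, h2⟩
  obtain ⟨f, f0, f1, -⟩ := exists_continuous_zero_one_of_isClosed
    ((hA.inter hB).inter ht) ((hA.inter hB).inter ht') hdis
  have hfr : ∀ z ∈ frontier {z | z ∈ A}, z ∈ A ∩ B := by
    intro z hz
    refine ⟨hA.frontier_subset hz, ?_⟩
    have h2 : z ∈ closure Aᶜ := by
      have := frontier_eq_closure_inter_closure (s := A) ▸ hz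
      exact this.2
    have h3 : Aᶜ ⊆ B := by
      intro w hw
      have : w ∈ A ∪ B := hAB ▸ mem_univ w
      exact this.resolve_left hw
    exact hB.closure_subset_iff.mpr h3 h2
  have key : ∀ z ∈ A ∩ B, Circle.exp (Real.pi * f z) = Circle.exp (-(Real.pi * f z)) := by
    intro z hz
    rcases hcov hz with h | h
    · have : f z = 0 := f0 ⟨hz, h⟩
      simp [this]
    · have : f z = 1 := f1 ⟨hz, h⟩
      rw [this, Circle.exp_eq_exp]
      exact ⟨1, by push_cast; ring⟩
  let g : C(ℂ, Circle) :=
    ⟨fun z => if z ∈ A then Circle.exp (Real.pi * f z) else Circle.exp (-(Real.pi * f z)),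
      Continuous.if (fun z hz => key z (hfr z hz)) (by fun_prop) (by fun_prop)⟩
  have gA : ∀ z ∈ A, g z = Circle.exp (Real.pi * f z) := fun z hz => if_pos hz
  have gB : ∀ z ∈ B, g z = Circle.exp (-(Real.pi * f z)) := by
    intro z hz
    by_cases h : z ∈ A
    · rw [gA z h, key z ⟨h, hz⟩]
    · exact if_neg h
  have fp : f p = 0 := f0 ⟨hp, hpt⟩
  have fq : f q = 1 := f1 ⟨hq, hqt⟩
  obtain ⟨F, ⟨F0, hF⟩, -⟩ := Circle.isCoveringMap_exp.existsUnique_continuousMap_lifts g p 0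
    (by rw [gA p hp.1, fp]; simp)
  have e1 : EqOn F (fun z => Real.pi * f z) A :=
    Circle.isCoveringMap_exp.eqOn_of_comp_eqOn cA (by fun_prop) (by fun_prop)
      (fun z hz => (congrFun hF z).trans (gA z hz)) hp.1 (by simp [F0, fp])
  have e2 : EqOn F (fun z => -(Real.pi * f z)) B :=
    Circle.isCoveringMap_exp.eqOn_of_comp_eqOn cB (by fun_prop) (by fun_prop)
      (fun z hz => (congrFun hF z).trans (gB z hz)) hp.2 (by simp [F0, fp])
  have h1 := e1 hq.1
  have h2 := e2 hq.2
  simp only [fq] at h1 h2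
  linarith [Real.pi_pos]

open Set Topology in
/-- The frontier of a component of an open set misses the open set. -/
theorem closure_component_inter (U : Set ℂ) (hU : IsOpen U) (x z : ℂ) (hz : z ∈ U)
    (h : z ∈ closure (connectedComponentIn U x)) : z ∈ connectedComponentIn U x := by
  have hn : connectedComponentIn U z ∈ 𝓝 z := connectedComponentIn_mem_nhds (hU.mem_nhds hz)
  obtain ⟨w, hw1, hw2⟩ := mem_closure_iff_nhds.mp h _ hn
  rw [connectedComponentIn_eq hw2, ← connectedComponentIn_eq hw1]
  exact mem_connectedComponentIn hz

open Set Topology in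
/-- The complement of a component of the complement of a closed connected set is connected. -/
theorem compl_component_preconnected (K : Set ℂ) (hK : IsClosed K) (cK : IsPreconnected K)
    (p : ℂ) (hp : p ∈ K) (q : ℂ) : IsPreconnected (connectedComponentIn Kᶜ q)ᶜ := by
  have hKD : K ⊆ (connectedComponentIn Kᶜ q)ᶜ := fun z hz hz' =>
    connectedComponentIn_subset _ _ hz' hz
  refine isPreconnected_of_forall p fun y hy => ?_
  by_cases hyK : y ∈ K
  · exact ⟨K, hKD, hp, hyK, cK⟩
  have hfr : ∀ z ∈ closure (connectedComponentIn Kᶜ y), z ∈ connectedComponentIn Kᶜ y ∨ z ∈ K := by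
    intro z hz
    by_cases h : z ∈ K
    · exact Or.inr h
    · exact Or.inl (closure_component_inter _ hK.isOpen_compl y z h hz)
  have hyy : y ∈ connectedComponentIn Kᶜ y := mem_connectedComponentIn hyK
  refine ⟨closure (connectedComponentIn Kᶜ y) ∪ K, ?_, Or.inr hp, Or.inl (subset_closure hyy), ?_⟩
  · rintro z (hz | hz)
    · rcases hfr z hz with h | h
      · intro h'
        apply hy
        rw [connectedComponentIn_eq h', ← connectedComponentIn_eq h]
        exact hyy
      · exact hKD h
    · exact hKD hz
  · refine IsPreconnected.union' ?_ isPreconnected_connectedComponentIn.closure cK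
    by_contra hne
    have hcl : IsClosed (connectedComponentIn Kᶜ y) := by
      refine isClosed_of_closure_subset fun z hz => (hfr z hz).resolve_right fun h => hne ⟨z, hz, h⟩
    have huniv : connectedComponentIn Kᶜ y = univ :=
      IsClopen.eq_univ ⟨hcl, hK.isOpen_compl.connectedComponentIn⟩ ⟨y, hyy⟩
    exact connectedComponentIn_subset Kᶜ y (huniv ▸ mem_univ p) hp

open Set Topology in
/-- A disconnected set is covered by two disjoint open sets both meeting it. -/
theorem exists_disjoint_open_separation (S : Set ℂ) (h : ¬ IsPreconnected S) :
    ∃ U V : Set ℂ, IsOpen U ∧ IsOpen V ∧ Disjoint U V ∧ S ⊆ U ∪ V ∧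
      (S ∩ U).Nonempty ∧ (S ∩ V).Nonempty := by
  unfold IsPreconnected at h
  push Not at h
  obtain ⟨u, v, hu, hv, hc, ⟨x, hx⟩, ⟨y, hy⟩, he⟩ := h
  have he' : ∀ z ∈ S, z ∈ u → z ∈ v → False := fun z h1 h2 h3 => by
    have : z ∈ S ∩ (u ∩ v) := ⟨h1, h2, h3⟩
    simp [he] at this
  have d1 : Disjoint (closure (S ∩ u)) (S ∩ v) := by
    rw [disjoint_left]
    rintro z hz ⟨hzS, hzv⟩
    obtain ⟨w, hw1, hw2, hw3⟩ := mem_closure_iff.mp hz v hv hzv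
    exact he' w hw2 hw3 hw1
  have d2 : Disjoint (S ∩ u) (closure (S ∩ v)) := by
    rw [disjoint_left]
    rintro z ⟨hzS, hzv⟩ hz
    obtain ⟨w, hw1, hw2, hw3⟩ := mem_closure_iff.mp hz u hu hzv
    exact he' w hw2 hw1 hw3
  have := CompletelyNormalSpace.completely_normal d1 d2
  rw [← separatedNhds_iff_disjoint] at this
  obtain ⟨U, V, hU, hV, hSU, hSV, hd⟩ := this
  refine ⟨U, V, hU, hV, hd, fun z hz => ?_, ⟨x, hx.1, hSU hx⟩, ⟨y, hy.1, hSV hy⟩⟩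
  exact (hc hz).imp (fun h => hSU ⟨hz, h⟩) (fun h => hSV ⟨hz, h⟩)

/-- A subset `S` of `ℂ` is disconnected iff there is a closed connected set `E ⊆ ℂ`
disjoint from `S` such that at least two different components of `ℂ \ E` meet `S`. -/
theorem disconnected_iff_separating_continuum (S : Set ℂ) :
    ¬ IsPreconnected S ↔
      ∃ E : Set ℂ, IsClosed E ∧ IsConnected E ∧ S ∩ E = ∅ ∧
        ∃ x y, x ∈ S ∧ y ∈ S ∧ x ∈ Eᶜ ∧ y ∈ Eᶜ ∧
          connectedComponentIn Eᶜ x ≠ connectedComponentIn Eᶜ y := by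
  constructor
  · intro h
    obtain ⟨U, V, hU, hV, hd, hc, ⟨p, hpS, hpU⟩, ⟨q, hqS, hqV⟩⟩ :=
      exists_disjoint_open_separation S h
    have hd' := Set.disjoint_left.mp hd
    set C := connectedComponentIn U p with hC
    have hCU : C ⊆ U := connectedComponentIn_subset U p
    have hpC : p ∈ C := mem_connectedComponentIn hpU
    have hCo : IsOpen C := hU.connectedComponentIn
    -- the closure of `C` misses `V`
    have hCV : ∀ z ∈ closure C, z ∉ V := fun z hz hzV => by
      obtain ⟨w, hw1, hw2⟩ := mem_closure_iff.mp hz V hV hzV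
      exact hd' (hCU hw2) hw1
    have hCl : IsClosed (closure C) := isClosed_closure
    set D := connectedComponentIn (closure C)ᶜ q with hD
    have hDo : IsOpen D := hCl.isOpen_compl.connectedComponentIn
    have hqD : q ∈ D := mem_connectedComponentIn fun hq => hCV q hq hqV
    have hDC : D ⊆ (closure C)ᶜ := connectedComponentIn_subset _ _
    have hDcl : IsPreconnected (closure D) := isPreconnected_connectedComponentIn.closure
    have hDco : IsPreconnected Dᶜ := compl_component_preconnected (closure C) hCl
      isPreconnected_connectedComponentIn.closure p (subset_closure hpC) q
    have hE : IsPreconnected (closure D ∩ Dᶜ) := by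
      refine plane_unicoherent _ _ isClosed_closure hDo.isClosed_compl hDcl hDco ?_
      ext z
      by_cases hz : z ∈ D
      · simp [subset_closure hz]
      · simp [hz]
    -- `closure D` misses `C`
    have hDC' : ∀ z ∈ closure D, z ∉ C := fun z hz hzC => by
      obtain ⟨w, hw1, hw2⟩ := mem_closure_iff.mp hz C hCo hzC
      exact hDC hw2 (subset_closure hw1)
    have hEC : ∀ z ∈ closure D ∩ Dᶜ, z ∈ closure C := by
      intro z hz
      by_contra hzC
      exact hz.2 (closure_component_inter _ hCl.isOpen_compl q z hzC hz.1)
    have hpE : p ∉ closure D ∩ Dᶜ := fun hp => hDC' p hp.1 hpC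
    have hqE : q ∉ closure D ∩ Dᶜ := fun hq => hq.2 hqD
    have hSE : S ∩ (closure D ∩ Dᶜ) = ∅ := by
      rw [Set.eq_empty_iff_forall_notMem]
      rintro z ⟨hzS, hz⟩
      rcases hc hzS with h | h
      · exact hDC' z hz.1 (closure_component_inter U hU p z h (hEC z hz))
      · exact hCV z (hEC z hz) h
    have hEn : (closure D ∩ Dᶜ).Nonempty := by
      by_contra hne
      have hDc : IsClosed D := isClosed_of_closure_subset fun z hz => by
        by_contra hzD
        exact hne ⟨z, hz, hzD⟩
      have hu : D = Set.univ := IsClopen.eq_univ ⟨hDc, hDo⟩ ⟨q, hqD⟩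
      exact hDC (hu ▸ Set.mem_univ p) (subset_closure hpC)
    refine ⟨closure D ∩ Dᶜ, isClosed_closure.inter hDo.isClosed_compl, ⟨hEn, hE⟩, hSE,
      p, q, hpS, hqS, hpE, hqE, fun heq => ?_⟩
    have hpre : IsPreconnected (connectedComponentIn (closure D ∩ Dᶜ)ᶜ p) :=
      isPreconnected_connectedComponentIn
    have hsub : connectedComponentIn (closure D ∩ Dᶜ)ᶜ p ⊆ (closure D ∩ Dᶜ)ᶜ :=
      connectedComponentIn_subset _ _
    obtain ⟨w, -, hw1, hw2⟩ := hpre D (closure D)ᶜ hDo isClosed_closure.isOpen_compl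
      (fun z hz => by
        by_cases h1 : z ∈ D
        · exact Or.inl h1
        · exact Or.inr fun h2 => hsub hz ⟨h2, h1⟩)
      ⟨q, heq ▸ mem_connectedComponentIn hqE, hqD⟩
      ⟨p, mem_connectedComponentIn hpE, fun h => hDC' p h hpC⟩
    exact hw2 (subset_closure hw1)
  · rintro ⟨E, -, -, hSE, x, y, hx, hy, -, -, hne⟩ hS
    apply hne
    have hsub : S ⊆ Eᶜ := fun z hz hzE => Set.eq_empty_iff_forall_notMem.mp hSE z ⟨hz, hzE⟩
    exact connectedComponentIn_eq (hS.subset_connectedComponentIn hx hsub hy)
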